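/- Let (𝒜, p) and (𝒜', p') be n𝒫-posets and let Σ : 𝒜 → Subd(𝒜') be a map with |Σ(x)|ₙ = p(x) for all x ∈ 𝒜 (a subdivision over n𝒫 defined on all of 𝒜). Then Σ is monotone (and hence a canonical subdivision over n𝒫) if and only if Σ(x|y) = Σ(y) for all x, y ∈ 𝒜 with y ≤ x, where Σ(x|y) denotes the unique Y ∈ Subd(𝒜') with Y ≤ Σ(x) and |Y|ₙ = p(y). -/

import Mathlib

open Pointwise

/-- A point of `ℝ^d` with integer coordinates. -/
def IsLatticePt {d : ℕ} (x : Fin d → ℝ) : Prop := ∀ i, ∃ z : ℤ, x i = (z : ℝ)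

/-- The subgroup `ℤ^d` of integral points of `ℝ^d`. -/
def intLattice (d : ℕ) : AddSubgroup (Fin d → ℝ) where
  carrier := {x | IsLatticePt x}
  zero_mem' := fun i => ⟨0, by simp⟩
  add_mem' := by
    rintro a b ha hb i
    obtain ⟨z, hz⟩ := ha i
    obtain ⟨w, hw⟩ := hb i
    exact ⟨z + w, by simp [hz, hw]⟩
  neg_mem' := by
    rintro a ha i
    obtain ⟨z, hz⟩ := ha i
    exact ⟨-z, by simp [hz]⟩

/-- A polytope: the convex hull of a nonempty finite set of points. -/
def IsPolytope {d : ℕ} (P : Set (Fin d → ℝ)) : Prop :=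
  ∃ V : Finset (Fin d → ℝ), V.Nonempty ∧ P = convexHull ℝ (V : Set (Fin d → ℝ))

/-- An integral polytope: the convex hull of a nonempty finite set of integral points. -/
def IsIntegralPolytope {d : ℕ} (P : Set (Fin d → ℝ)) : Prop :=
  ∃ V : Finset (Fin d → ℝ), V.Nonempty ∧ (∀ v ∈ V, IsLatticePt v) ∧
    P = convexHull ℝ (V : Set (Fin d → ℝ))

/-- A simplex: the convex hull of a nonempty affinely independent finite set. -/
def IsSimplex {d : ℕ} (P : Set (Fin d → ℝ)) : Prop :=
  ∃ V : Finset (Fin d → ℝ), V.Nonempty ∧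
    AffineIndependent ℝ (Subtype.val : ↥(V : Set (Fin d → ℝ)) → (Fin d → ℝ)) ∧
    P = convexHull ℝ (V : Set (Fin d → ℝ))

/-- An integral simplex. -/
def IsIntegralSimplex {d : ℕ} (P : Set (Fin d → ℝ)) : Prop :=
  ∃ V : Finset (Fin d → ℝ), V.Nonempty ∧ (∀ v ∈ V, IsLatticePt v) ∧
    AffineIndependent ℝ (Subtype.val : ↥(V : Set (Fin d → ℝ)) → (Fin d → ℝ)) ∧
    P = convexHull ℝ (V : Set (Fin d → ℝ))

/-- The set of differences of vertices (= extreme points) of a polytope. -/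
def vertexDiffs {d : ℕ} (P : Set (Fin d → ℝ)) : Set (Fin d → ℝ) :=
  {w | ∃ u ∈ P.extremePoints ℝ, ∃ v ∈ P.extremePoints ℝ, w = u - v}

/-- `L(P)`: the subgroup of `ℤ^d` generated by differences of vertices of `P`. -/
def latL {d : ℕ} (P : Set (Fin d → ℝ)) : AddSubgroup (Fin d → ℝ) :=
  AddSubgroup.closure (vertexDiffs P)

/-- `N(P)`: the intersection of the real span of `L(P)` with `ℤ^d`. -/
def latN {d : ℕ} (P : Set (Fin d → ℝ)) : AddSubgroup (Fin d → ℝ) :=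
  (Submodule.span ℝ (vertexDiffs P)).toAddSubgroup ⊓ intLattice d

/-- The (normalized) index of an integral polytope: the group index `[N(P) : L(P)]`. -/
noncomputable def polyIndex {d : ℕ} (P : Set (Fin d → ℝ)) : ℕ :=
  ((latL P).addSubgroupOf (latN P)).index

/-- A unimodular simplex: an integral simplex of index 1. -/
def IsUnimodularSimplex {d : ℕ} (P : Set (Fin d → ℝ)) : Prop :=
  IsIntegralSimplex P ∧ polyIndex P = 1

/-- `F` is a face of `P`: the (nonempty) set of maximizers on `P` of a linear functional. -/
def IsFaceOf {d : ℕ} (F P : Set (Fin d → ℝ)) : Prop :=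
  F.Nonempty ∧ ∃ φ : (Fin d → ℝ) →ₗ[ℝ] ℝ, F = {x ∈ P | ∀ y ∈ P, φ y ≤ φ x}

/-- A triangulation of `Q`: a finite, face-closed collection of simplices with union `Q`,
any two of which meet in a (possibly empty) common face. -/
def IsTriangulation {d : ℕ} (T : Set (Set (Fin d → ℝ))) (Q : Set (Fin d → ℝ)) : Prop :=
  T.Finite ∧ (∀ S ∈ T, IsSimplex S) ∧ ⋃₀ T = Q ∧
    (∀ S ∈ T, ∀ F, IsFaceOf F S → F ∈ T) ∧
    ∀ S₁ ∈ T, ∀ S₂ ∈ T, S₁ ∩ S₂ = ∅ ∨ (IsFaceOf (S₁ ∩ S₂) S₁ ∧ IsFaceOf (S₁ ∩ S₂) S₂)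

/-- A unimodular triangulation: all of its simplices are unimodular. -/
def IsUnimodularTriangulation {d : ℕ} (T : Set (Set (Fin d → ℝ))) (Q : Set (Fin d → ℝ)) : Prop :=
  IsTriangulation T Q ∧ ∀ S ∈ T, IsUnimodularSimplex S

/-- A polytopal complex. -/
def IsPolytopalComplex {d : ℕ} (X : Set (Set (Fin d → ℝ))) : Prop :=
  X.Finite ∧ (∀ P ∈ X, IsPolytope P) ∧
    (∀ P ∈ X, ∀ F, IsFaceOf F P → F ∈ X) ∧
    ∀ P ∈ X, ∀ Q ∈ X, P ≠ Q → intrinsicInterior ℝ P ∩ intrinsicInterior ℝ Q = ∅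

/-- The order on `n𝒫`: each `F i` is the (nonempty) face of `P i` with respect to one single
linear functional. -/
def NPFace {d n : ℕ} (F P : Fin n → Set (Fin d → ℝ)) : Prop :=
  ∃ φ : (Fin d → ℝ) →ₗ[ℝ] ℝ, ∀ i, (F i).Nonempty ∧ F i = {x ∈ P i | ∀ y ∈ P i, φ y ≤ φ x}

/-- The Minkowski sum of an `n`-tuple of subsets of `ℝ^d`. -/
def minkSum {d n : ℕ} (P : Fin n → Set (Fin d → ℝ)) : Set (Fin d → ℝ) :=
  ∑ i, P i

/-- `X` is an `𝒜`-complex for the `n𝒫`-poset `(𝒜, p)`: the Minkowski sums of the tuples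
`p x`, `x ∈ X`, form a polytopal complex, and `x ↦ Σ(p x)` is a poset isomorphism from `X`
onto this complex (ordered by the face relation). -/
def IsAComplex {d n : ℕ} {𝒜 : Type*} [PartialOrder 𝒜]
    (p : 𝒜 → Fin n → Set (Fin d → ℝ)) (X : Set 𝒜) : Prop :=
  IsPolytopalComplex ((fun x => minkSum (p x)) '' X) ∧
  Set.InjOn (fun x => minkSum (p x)) X ∧
  ∀ x ∈ X, ∀ y ∈ X, (x ≤ y ↔ IsFaceOf (minkSum (p x)) (minkSum (p y)))

/-- The support of an `𝒜`-complex. -/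
def suppOf {d n : ℕ} {𝒜 : Type*} (p : 𝒜 → Fin n → Set (Fin d → ℝ)) (X : Set 𝒜) :
    Set (Fin d → ℝ) :=
  ⋃ x ∈ X, minkSum (p x)

/-- The `n`-support of an `𝒜`-complex. -/
def nsuppOf {d n : ℕ} {𝒜 : Type*} (p : 𝒜 → Fin n → Set (Fin d → ℝ)) (X : Set 𝒜) :
    Fin n → Set (Fin d → ℝ) :=
  fun k => ⋃ x ∈ X, p x k

/-- An `𝒜`-subdivision: an `𝒜`-complex whose support is a polytope. -/
def IsASubdivision {d n : ℕ} {𝒜 : Type*} [PartialOrder 𝒜]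
    (p : 𝒜 → Fin n → Set (Fin d → ℝ)) (X : Set 𝒜) : Prop :=
  IsAComplex p X ∧ IsPolytope (suppOf p X)

/-- The order on `Subd(𝒜)`: `X'` is a subcomplex of `X` whose support is a face of the
support of `X`. -/
def SubdLE {d n : ℕ} {𝒜 : Type*} [PartialOrder 𝒜]
    (p : 𝒜 → Fin n → Set (Fin d → ℝ)) (X' X : Set 𝒜) : Prop :=
  X' ⊆ X ∧ IsAComplex p X' ∧ IsFaceOf (suppOf p X') (suppOf p X)

/-- Farkas' lemma: a vector on which every functional nonpositive on a finite family is nonpositive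
is a nonnegative combination of the family. -/
theorem exists_nonneg_combination {E ι : Type*} [AddCommGroup E] [Module ℝ E] (s : Finset ι)
    (a : ι → E) (b : E)
    (h : ∀ φ : E →ₗ[ℝ] ℝ, (∀ i ∈ s, φ (a i) ≤ 0) → φ b ≤ 0) :
    ∃ c : ι → ℝ, (∀ i, 0 ≤ c i) ∧ b = ∑ i ∈ s, c i • a i := by
  classical
  induction s using Finset.induction_on generalizing a b with
  | empty =>
    refine ⟨0, fun _ => le_rfl, ?_⟩
    rw [Finset.sum_empty, ← Module.forall_dual_apply_eq_zero_iff ℝ]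
    intro φ
    have h₁ := h φ (by simp)
    have h₂ := h (-φ) (by simp)
    rw [LinearMap.neg_apply] at h₂
    linarith
  | insert m s hm ih =>
    by_cases hs : ∀ φ : E →ₗ[ℝ] ℝ, (∀ i ∈ s, φ (a i) ≤ 0) → φ b ≤ 0
    · obtain ⟨c, hc, hb⟩ := ih a b hs
      refine ⟨Function.update c m 0, fun i => ?_, ?_⟩
      · by_cases hi : i = m
        · simp [hi]
        · simp [hi, hc]
      · rw [Finset.sum_insert hm, Function.update_self, zero_smul, zero_add, hb]
        refine Finset.sum_congr rfl fun i hi => ?_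
        rw [Function.update_of_ne (ne_of_mem_of_not_mem hi hm)]
    · push Not at hs
      obtain ⟨θ, hθ, hθb⟩ := hs
      have hθm : 0 < θ (a m) := by
        by_contra! hneg
        refine absurd (h θ fun i hi => ?_) (not_le.2 hθb)
        rcases Finset.mem_insert.1 hi with rfl | hi
        exacts [hneg, hθ i hi]
      obtain ⟨c, hc, hb⟩ := ih (fun i => a i - (θ (a i) / θ (a m)) • a m)
        (b - (θ b / θ (a m)) • a m) (fun φ hφ => by
          have key : ∀ x, (φ - (φ (a m) / θ (a m)) • θ) x
              = φ (x - (θ x / θ (a m)) • a m) := by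
            intro x
            simp only [LinearMap.sub_apply, LinearMap.smul_apply, map_sub, map_smul, smul_eq_mul]
            ring
          rw [← key]
          refine h _ fun i hi => ?_
          rcases Finset.mem_insert.1 hi with rfl | hi
          · rw [key, div_self hθm.ne', one_smul, sub_self, map_zero]
          · rw [key]
            exact hφ i hi)
      have hsum : ∑ i ∈ s, c i * (θ (a i) / θ (a m)) ≤ 0 :=
        Finset.sum_nonpos fun i hi => mul_nonpos_of_nonneg_of_nonpos (hc i)
          (div_nonpos_of_nonpos_of_nonneg (hθ i hi) hθm.le)
      refine ⟨Function.update c m (θ b / θ (a m) - ∑ i ∈ s, c i * (θ (a i) / θ (a m))),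
        fun i => ?_, ?_⟩
      · by_cases hi : i = m
        · subst hi
          have := div_pos hθb hθm
          rw [Function.update_self]
          linarith
        · simp [hi, hc]
      · have hcongr : ∑ i ∈ s, Function.update c m
            (θ b / θ (a m) - ∑ i ∈ s, c i * (θ (a i) / θ (a m))) i • a i
            = ∑ i ∈ s, c i • a i :=
          Finset.sum_congr rfl fun i hi => by
            rw [Function.update_of_ne (ne_of_mem_of_not_mem hi hm)]
        rw [Finset.sum_insert hm, Function.update_self, hcongr]
        simp only [smul_sub, smul_smul, Finset.sum_sub_distrib, ← Finset.sum_smul] at hb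
        refine (sub_eq_iff_eq_add.1 hb).trans ?_
        rw [sub_smul]
        abel

/-- The directions pointing from `u` into a convex set are closed under nonnegative
combinations. -/
theorem Convex.exists_add_smul_sum_mem {E ι : Type*} [AddCommGroup E] [Module ℝ E] {P : Set E}
    (hP : Convex ℝ P) {u : E} (hu : u ∈ P) (s : Finset ι) (x : ι → E) (hx : ∀ i ∈ s, x i ∈ P)
    (c : ι → ℝ) (hc : ∀ i, 0 ≤ c i) :
    ∃ ε : ℝ, 0 < ε ∧ u + ε • ∑ i ∈ s, c i • (x i - u) ∈ P := by
  have hS : 0 ≤ ∑ i ∈ s, c i := Finset.sum_nonneg fun i _ => hc i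
  rcases hS.eq_or_lt with hS | hS
  · refine ⟨1, one_pos, ?_⟩
    have hz := (Finset.sum_eq_zero_iff_of_nonneg fun i _ => hc i).1 hS.symm
    rw [Finset.sum_eq_zero fun i hi => by rw [hz i hi, zero_smul], smul_zero, add_zero]
    exact hu
  · refine ⟨(∑ i ∈ s, c i)⁻¹, inv_pos.2 hS, ?_⟩
    have := hP.centerMass_mem (t := s) (w := c) (z := x) (fun i _ => hc i) hS hx
    convert this using 1
    simp only [Finset.centerMass, smul_sub, Finset.sum_sub_distrib, ← Finset.sum_smul, smul_smul]
    rw [inv_mul_cancel₀ hS.ne', one_smul]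
    abel

theorem IsPolytope.convex {d : ℕ} {P : Set (Fin d → ℝ)} (hP : IsPolytope P) : Convex ℝ P := by
  obtain ⟨V, -, rfl⟩ := hP
  exact convex_convexHull ℝ _

theorem IsPolytope.isCompact {d : ℕ} {P : Set (Fin d → ℝ)} (hP : IsPolytope P) :
    IsCompact P := by
  obtain ⟨V, -, rfl⟩ := hP
  exact V.finite_toSet.isCompact_convexHull (𝕜 := ℝ)

theorem IsPolytope.nonempty {d : ℕ} {P : Set (Fin d → ℝ)} (hP : IsPolytope P) :
    P.Nonempty := by
  obtain ⟨V, hV, rfl⟩ := hP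
  exact convexHull_nonempty_iff.2 hV

/-- The tangent cone of a polytope at a point is dual to the normal cone. -/
theorem IsPolytope.exists_add_smul_mem {d : ℕ} {P : Set (Fin d → ℝ)} (hP : IsPolytope P)
    {u v : Fin d → ℝ} (hu : u ∈ P)
    (h : ∀ φ : (Fin d → ℝ) →ₗ[ℝ] ℝ, (∀ y ∈ P, φ y ≤ φ u) → φ v ≤ 0) :
    ∃ ε : ℝ, 0 < ε ∧ u + ε • v ∈ P := by
  have hc := hP.convex
  obtain ⟨V, -, rfl⟩ := hP
  obtain ⟨c, hc0, rfl⟩ := exists_nonneg_combination V (fun x => x - u) v fun φ hφ =>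
    h φ fun y hy => by
      have hsub : convexHull ℝ (V : Set (Fin d → ℝ)) ⊆ {y | φ y ≤ φ u} :=
        convexHull_min (fun x hx => by simpa using hφ x hx)
          (convex_halfSpace_le φ.isLinear _)
      exact hsub hy
  exact hc.exists_add_smul_sum_mem hu V id (fun i hi => subset_convexHull ℝ _ hi) c hc0

/-- The set of maximizers of `φ` on `P`. -/
def maxFace {d : ℕ} (φ : (Fin d → ℝ) →ₗ[ℝ] ℝ) (P : Set (Fin d → ℝ)) : Set (Fin d → ℝ) :=
  {x ∈ P | ∀ y ∈ P, φ y ≤ φ x}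

theorem isExposed_maxFace {d : ℕ} (φ : (Fin d → ℝ) →ₗ[ℝ] ℝ) (P : Set (Fin d → ℝ)) :
    IsExposed ℝ P (maxFace φ P) :=
  fun _ => ⟨LinearMap.toContinuousLinearMap φ, rfl⟩

theorem maxFace_convexHull {d : ℕ} (φ : (Fin d → ℝ) →ₗ[ℝ] ℝ) {V : Set (Fin d → ℝ)}
    (hV : V.Finite) :
    maxFace φ (convexHull ℝ V) = convexHull ℝ (V ∩ maxFace φ (convexHull ℝ V)) := by
  have hexp := isExposed_maxFace φ (convexHull ℝ V)
  have hconv : Convex ℝ (maxFace φ (convexHull ℝ V)) := hexp.convex (convex_convexHull ℝ V)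
  have hcomp : IsCompact (maxFace φ (convexHull ℝ V)) :=
    hexp.isCompact (hV.isCompact_convexHull (𝕜 := ℝ))
  refine subset_antisymm ?_ (convexHull_min Set.inter_subset_right hconv)
  have hsub : (maxFace φ (convexHull ℝ V)).extremePoints ℝ ⊆ V ∩ maxFace φ (convexHull ℝ V) :=
    fun x hx => ⟨extremePoints_convexHull_subset
      (hexp.isExtreme.extremePoints_subset_extremePoints hx), hx.1⟩
  calc maxFace φ (convexHull ℝ V)
      = closure (convexHull ℝ ((maxFace φ (convexHull ℝ V)).extremePoints ℝ)) :=
        (closure_convexHull_extremePoints hcomp hconv).symm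
    _ ⊆ closure (convexHull ℝ (V ∩ maxFace φ (convexHull ℝ V))) :=
        closure_mono (convexHull_mono hsub)
    _ = convexHull ℝ (V ∩ maxFace φ (convexHull ℝ V)) :=
        ((hV.subset Set.inter_subset_left).isClosed_convexHull ℝ).closure_eq

theorem IsFaceOf.isPolytope {d : ℕ} {F P : Set (Fin d → ℝ)} (hF : IsFaceOf F P)
    (hP : IsPolytope P) : IsPolytope F := by
  classical
  obtain ⟨V, -, rfl⟩ := hP
  obtain ⟨hne, φ, hφ⟩ := hF
  have hF : F = convexHull ℝ (V ∩ maxFace φ (convexHull ℝ V)) :=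
    hφ.trans (maxFace_convexHull φ V.finite_toSet)
  refine ⟨V.filter (· ∈ maxFace φ (convexHull ℝ V)), ?_, ?_⟩
  · rw [hF, convexHull_nonempty_iff] at hne
    obtain ⟨x, hx⟩ := hne
    exact ⟨x, Finset.mem_filter.2 hx⟩
  · rw [hF, Finset.coe_filter]
    rfl

/-- A point of a convex set that can be moved a little away from every other point of the set
is in its relative interior. -/
theorem Convex.mem_intrinsicInterior_of_forall {d : ℕ} {s : Set (Fin d → ℝ)} (hs : Convex ℝ s)
    {u : Fin d → ℝ} (hu : u ∈ s) (h : ∀ v ∈ s, ∃ ε : ℝ, 0 < ε ∧ u + ε • (u - v) ∈ s) :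
    u ∈ intrinsicInterior ℝ s := by
  obtain ⟨i, hi⟩ := Set.Nonempty.intrinsicInterior hs ⟨u, hu⟩
  obtain ⟨ε, hε, hb⟩ := h i (intrinsicInterior_subset hi)
  set b := u + ε • (u - i) with hbdef
  obtain ⟨i', hi', hi'i⟩ := mem_intrinsicInterior.1 hi
  let g : affineSpan ℝ s → affineSpan ℝ s := fun y =>
    ⟨AffineMap.lineMap b (y : Fin d → ℝ) ((1 + ε) / ε),
      AffineMap.lineMap_mem _ (subset_affineSpan ℝ s hb) y.2⟩
  have hg : Continuous g := by
    refine Continuous.subtype_mk ?_ _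
    simp only [AffineMap.lineMap_apply_module]
    fun_prop
  refine mem_intrinsicInterior.2 ⟨⟨u, subset_affineSpan ℝ s hu⟩, ?_, rfl⟩
  refine mem_interior.2 ⟨g ⁻¹' interior ((↑) ⁻¹' s), fun y hy => ?_,
    isOpen_interior.preimage hg, ?_⟩
  · have hgy : ((g y : affineSpan ℝ s) : Fin d → ℝ) ∈ s :=
      interior_subset (s := ((↑) ⁻¹' s : Set (affineSpan ℝ s))) hy
    have := hs hb hgy (a := 1 / (1 + ε)) (b := ε / (1 + ε)) (by positivity) (by positivity)
      (by field_simp)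
    rw [Set.mem_preimage]
    convert this using 1
    simp only [g, AffineMap.lineMap_apply_module]
    ext j
    simp only [Pi.add_apply, Pi.smul_apply, smul_eq_mul]
    field_simp
    ring
  · have : g ⟨u, subset_affineSpan ℝ s hu⟩ = i' := by
      apply Subtype.ext
      rw [hi'i]
      simp only [g, AffineMap.lineMap_apply_module, hbdef]
      ext j
      simp only [Pi.add_apply, Pi.smul_apply, Pi.sub_apply, smul_eq_mul]
      field_simp
      ring
    rw [Set.mem_preimage, this]
    exact hi'

/-- Every point of a polytope is in the relative interior of some face. -/
theorem IsPolytope.exists_isFaceOf_mem_intrinsicInterior {d : ℕ} {P : Set (Fin d → ℝ)}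
    (hP : IsPolytope P) {u : Fin d → ℝ} (hu : u ∈ P) :
    ∃ F, IsFaceOf F P ∧ u ∈ intrinsicInterior ℝ F := by
  classical
  have hP' := hP
  obtain ⟨V, -, hPV⟩ := hP
  let f : ((Fin d → ℝ) →ₗ[ℝ] ℝ) → ℕ := fun φ => (V.filter (· ∈ maxFace φ P)).card
  obtain ⟨φ, hφ, hmin⟩ := WellFounded.has_min (InvImage.wf f wellFounded_lt)
    {φ | u ∈ maxFace φ P} ⟨0, hu, by simp⟩
  refine ⟨maxFace φ P, ⟨⟨u, hφ⟩, φ, rfl⟩, ?_⟩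
  have hconv : ∀ χ, Convex ℝ (maxFace χ P) := fun χ => (isExposed_maxFace χ P).convex hP'.convex
  have hsub : ∀ χ, u ∈ maxFace χ P → maxFace φ P ⊆ maxFace χ P := by
    intro χ hχ
    have hle : maxFace (φ + χ) P ⊆ maxFace φ P ∩ maxFace χ P := by
      rintro x ⟨hx, hmax⟩
      have h₁ := hmax u hu
      have h₂ := hφ.2 x hx
      have h₃ := hχ.2 x hx
      simp only [LinearMap.add_apply] at h₁
      exact ⟨⟨hx, fun y hy => (hφ.2 y hy).trans (by linarith)⟩,
        ⟨hx, fun y hy => (hχ.2 y hy).trans (by linarith)⟩⟩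
    have hmem : u ∈ maxFace (φ + χ) P :=
      ⟨hu, fun y hy => add_le_add (hφ.2 y hy) (hχ.2 y hy)⟩
    have heq : V.filter (· ∈ maxFace (φ + χ) P) = V.filter (· ∈ maxFace φ P) :=
      Finset.eq_of_subset_of_card_le
        (fun x hx => Finset.mem_filter.2
          ⟨(Finset.mem_filter.1 hx).1, (hle (Finset.mem_filter.1 hx).2).1⟩)
        (not_lt.1 (hmin _ hmem))
    have hface : maxFace φ P = convexHull ℝ (V ∩ maxFace φ P) := by
      rw [hPV]
      exact maxFace_convexHull φ V.finite_toSet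
    rw [hface]
    refine convexHull_min (fun x hx => ?_) (hconv χ)
    have hx' : x ∈ V.filter (· ∈ maxFace (φ + χ) P) := heq ▸ Finset.mem_filter.2 hx
    exact (hle (Finset.mem_filter.1 hx').2).2
  refine (hconv φ).mem_intrinsicInterior_of_forall hφ fun v hv => ?_
  obtain ⟨ε, hε, hmem⟩ := hP'.exists_add_smul_mem (v := u - v) hu fun χ hχ => by
    rw [map_sub, sub_nonpos]
    exact (hsub χ ⟨hu, hχ⟩ hv).2 u hu
  refine ⟨ε, hε, hmem, fun y hy => (hφ.2 y hy).trans ?_⟩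
  have := hv.2 u hu
  have := hφ.2 v hv.1
  rw [map_add, map_smul, map_sub, smul_eq_mul, show φ u - φ v = 0 by linarith]
  simp

theorem mem_minkSum {d n : ℕ} {P : Fin n → Set (Fin d → ℝ)} {u : Fin d → ℝ} :
    u ∈ minkSum P ↔ ∃ a : Fin n → Fin d → ℝ, (∀ j, a j ∈ P j) ∧ ∑ j, a j = u := by
  rw [minkSum, Set.mem_fintype_sum]
  simp only [exists_prop]

theorem sum_mem_minkSum {d n : ℕ} {P : Fin n → Set (Fin d → ℝ)} {a : Fin n → Fin d → ℝ}
    (ha : ∀ j, a j ∈ P j) : ∑ j, a j ∈ minkSum P :=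
  mem_minkSum.2 ⟨a, ha, rfl⟩

theorem forall_update_mem {ι E : Type*} [DecidableEq ι] {P : ι → Set E} {a : ι → E}
    (ha : ∀ j, a j ∈ P j) {k : ι} {b : E} (hb : b ∈ P k) (j : ι) :
    Function.update a k b j ∈ P j := by
  by_cases hj : j = k
  · subst hj
    simpa using hb
  · simpa [hj] using ha j

theorem map_sum_update {E ι : Type*} [AddCommGroup E] [Module ℝ E] [Fintype ι] [DecidableEq ι]
    (φ : E →ₗ[ℝ] ℝ) (a : ι → E) (k : ι) (b : E) :
    φ (∑ j, Function.update a k b j) = φ (∑ j, a j) + (φ b - φ (a k)) := by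
  rw [Finset.sum_update_of_mem (Finset.mem_univ k), Finset.sum_eq_add_sum_sdiff_singleton_of_mem
    (Finset.mem_univ k) a, map_add, map_add]
  ring

/-- If a sum of points maximizes `φ` over a set that contains all the sums of points of the `G j`,
then every summand maximizes `φ`. -/
theorem le_of_forall_le_map_sum {d n : ℕ} {G : Fin n → Set (Fin d → ℝ)} {Q : Set (Fin d → ℝ)}
    (hG : ∀ g : Fin n → Fin d → ℝ, (∀ j, g j ∈ G j) → ∑ j, g j ∈ Q)
    {φ : (Fin d → ℝ) →ₗ[ℝ] ℝ} {a : Fin n → Fin d → ℝ} (ha : ∀ j, a j ∈ G j)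
    (hmax : ∀ y ∈ Q, φ y ≤ φ (∑ j, a j)) {k : Fin n} {g : Fin d → ℝ} (hg : g ∈ G k) :
    φ g ≤ φ (a k) := by
  have := hmax _ (hG _ (forall_update_mem ha hg))
  rw [map_sum_update] at this
  linarith

/-- If a point of a Minkowski sum lies in the sum of the faces with respect to `φ`, then so
do all its decompositions. -/
theorem NPFace.mem_of_sum_mem {d n : ℕ} {F P : Fin n → Set (Fin d → ℝ)} (h : NPFace F P)
    {a : Fin n → Fin d → ℝ} (ha : ∀ j, a j ∈ P j) (hs : ∑ j, a j ∈ minkSum F) (j : Fin n) :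
    a j ∈ F j := by
  obtain ⟨φ, hφ⟩ := h
  obtain ⟨b, hb, hba⟩ := mem_minkSum.1 hs
  have hb' : ∀ i, b i ∈ P i ∧ ∀ y ∈ P i, φ y ≤ φ (b i) := fun i => by
    have := hb i
    rw [(hφ i).2] at this
    exact this
  have heq : ∑ i, φ (a i) = ∑ i, φ (b i) := by rw [← map_sum, ← map_sum, hba]
  have hj := (Finset.sum_eq_sum_iff_of_le fun i _ => (hb' i).2 (a i) (ha i)).1 heq j
    (Finset.mem_univ j)
  rw [(hφ j).2]
  exact ⟨ha j, fun y hy => hj ▸ (hb' j).2 y hy⟩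

theorem NPFace.subset {d n : ℕ} {F P : Fin n → Set (Fin d → ℝ)} (h : NPFace F P) (j : Fin n) :
    F j ⊆ P j := by
  obtain ⟨φ, hφ⟩ := h
  rw [(hφ j).2]
  exact Set.sep_subset _ _

theorem mem_suppOf {d n : ℕ} {𝒜 : Type*} {p : 𝒜 → Fin n → Set (Fin d → ℝ)} {X : Set 𝒜}
    {u : Fin d → ℝ} : u ∈ suppOf p X ↔ ∃ x ∈ X, u ∈ minkSum (p x) := by
  simp [suppOf]

theorem mem_nsuppOf {d n : ℕ} {𝒜 : Type*} {p : 𝒜 → Fin n → Set (Fin d → ℝ)} {X : Set 𝒜}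
    {k : Fin n} {u : Fin d → ℝ} : u ∈ nsuppOf p X k ↔ ∃ x ∈ X, u ∈ p x k := by
  simp [nsuppOf]

theorem sum_mem_suppOf {d n : ℕ} {𝒜 : Type*} {p : 𝒜 → Fin n → Set (Fin d → ℝ)} {X : Set 𝒜}
    {x : 𝒜} (hx : x ∈ X) {a : Fin n → Fin d → ℝ}
    (ha : ∀ j, a j ∈ p x j) :
    ∑ j, a j ∈ suppOf p X :=
  mem_suppOf.2 ⟨x, hx, sum_mem_minkSum ha⟩

section AComplex

variable {d n : ℕ} {𝒜 : Type*} [PartialOrder 𝒜] {p : 𝒜 → Fin n → Set (Fin d → ℝ)} {X : Set 𝒜}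

theorem IsAComplex.finite (hX : IsAComplex p X) : X.Finite :=
  hX.1.1.of_finite_image hX.2.1

theorem IsAComplex.isPolytope (hX : IsAComplex p X) {x : 𝒜} (hx : x ∈ X) :
    IsPolytope (minkSum (p x)) :=
  hX.1.2.1 _ ⟨x, hx, rfl⟩

theorem IsAComplex.exists_le_of_isFaceOf (hX : IsAComplex p X) {x : 𝒜} (hx : x ∈ X)
    {F : Set (Fin d → ℝ)} (hF : IsFaceOf F (minkSum (p x))) :
    ∃ w ∈ X, w ≤ x ∧ minkSum (p w) = F := by
  obtain ⟨w, hw, rfl⟩ := hX.1.2.2.1 _ ⟨x, hx, rfl⟩ F hF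
  exact ⟨w, hw, (hX.2.2 w hw x hx).2 hF, rfl⟩

theorem IsAComplex.exists_le_mem_intrinsicInterior (hX : IsAComplex p X) {x : 𝒜} (hx : x ∈ X)
    {u : Fin d → ℝ} (hu : u ∈ minkSum (p x)) :
    ∃ w ∈ X, w ≤ x ∧ u ∈ intrinsicInterior ℝ (minkSum (p w)) := by
  obtain ⟨F, hF, huF⟩ := (hX.isPolytope hx).exists_isFaceOf_mem_intrinsicInterior hu
  obtain ⟨w, hw, hwx, rfl⟩ := hX.exists_le_of_isFaceOf hx hF
  exact ⟨w, hw, hwx, huF⟩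

theorem IsAComplex.eq_of_mem_intrinsicInterior (hX : IsAComplex p X) {x y : 𝒜} (hx : x ∈ X)
    (hy : y ∈ X) {u : Fin d → ℝ} (hux : u ∈ intrinsicInterior ℝ (minkSum (p x)))
    (huy : u ∈ intrinsicInterior ℝ (minkSum (p y))) : x = y := by
  by_contra hne
  have := hX.1.2.2.2 _ ⟨x, hx, rfl⟩ _ ⟨y, hy, rfl⟩ fun h => hne (hX.2.1 hx hy h)
  exact Set.notMem_empty u (this ▸ ⟨hux, huy⟩)

/-- A decomposition of a point with respect to one cell is a decomposition with respect to every
cell which contains the point. -/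
theorem IsAComplex.mem_of_sum_mem (hX : IsAComplex p X)
    (hmono : ∀ x y : 𝒜, x ≤ y → NPFace (p x) (p y)) {x y : 𝒜} (hx : x ∈ X) (hy : y ∈ X)
    {a : Fin n → Fin d → ℝ} (ha : ∀ j, a j ∈ p x j) (hs : ∑ j, a j ∈ minkSum (p y)) (j : Fin n) :
    a j ∈ p y j := by
  obtain ⟨w, hw, hwx, hux⟩ := hX.exists_le_mem_intrinsicInterior hx (sum_mem_minkSum ha)
  obtain ⟨w', hw', hwy, huy⟩ := hX.exists_le_mem_intrinsicInterior hy hs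
  obtain rfl := hX.eq_of_mem_intrinsicInterior hw hw' hux huy
  exact (hmono _ _ hwy).subset j
    ((hmono _ _ hwx).mem_of_sum_mem ha (intrinsicInterior_subset hux) j)

theorem IsAComplex.mono (hX : IsAComplex p X) {Y : Set 𝒜} (hYX : Y ⊆ X)
    (hdown : ∀ y ∈ Y, ∀ x ∈ X, x ≤ y → x ∈ Y) : IsAComplex p Y := by
  refine ⟨⟨hX.1.1.subset (Set.image_mono hYX), ?_, ?_, ?_⟩, hX.2.1.mono hYX,
    fun x hx y hy => hX.2.2 x (hYX hx) y (hYX hy)⟩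
  · rintro _ ⟨y, hy, rfl⟩
    exact hX.isPolytope (hYX hy)
  · rintro _ ⟨y, hy, rfl⟩ F hF
    obtain ⟨w, hw, hwy, rfl⟩ := hX.exists_le_of_isFaceOf (hYX hy) hF
    exact ⟨w, hdown y hy w hw hwy, rfl⟩
  · rintro _ ⟨x, hx, rfl⟩ _ ⟨y, hy, rfl⟩
    exact hX.1.2.2.2 _ ⟨x, hYX hx, rfl⟩ _ ⟨y, hYX hy, rfl⟩

/-- A subcomplex is determined by its support. -/
theorem IsAComplex.subset_of_suppOf_subset (hX : IsAComplex p X) {Y Z : Set 𝒜} (hYX : Y ⊆ X)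
    (hZX : Z ⊆ X) (hZ : IsAComplex p Z) (h : suppOf p Y ⊆ suppOf p Z) : Y ⊆ Z := by
  intro y hy
  have hP := hX.isPolytope (hYX hy)
  obtain ⟨u, hu⟩ := Set.Nonempty.intrinsicInterior hP.convex hP.nonempty
  obtain ⟨z, hz, huz⟩ := mem_suppOf.1 (h (mem_suppOf.2 ⟨y, hy, intrinsicInterior_subset hu⟩))
  obtain ⟨w, hw, -, huw⟩ := hZ.exists_le_mem_intrinsicInterior hz huz
  rwa [hX.eq_of_mem_intrinsicInterior (hYX hy) (hZX hw) hu huw]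

theorem SubdLE.isASubdivision {Y : Set 𝒜} (h : SubdLE p Y X) (hX : IsASubdivision p X) :
    IsASubdivision p Y :=
  ⟨h.2.1, h.2.2.isPolytope hX.2⟩

/-- Starting at a point of the support of a subdivision and moving towards another point of the
support, one remains for a while in a single cell through the starting point. -/
theorem IsASubdivision.exists_cell (hX : IsASubdivision p X)
    (hmono : ∀ x y : 𝒜, x ≤ y → NPFace (p x) (p y)) {x : 𝒜} (hx : x ∈ X)
    {a : Fin n → Fin d → ℝ} (ha : ∀ j, a j ∈ p x j) {v : Fin d → ℝ} {δ : ℝ} (hδ : 0 < δ)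
    (hv : ∑ j, a j + δ • v ∈ suppOf p X) :
    ∃ z ∈ X, (∀ j, a j ∈ p z j) ∧ ∃ ε : ℝ, 0 < ε ∧ ε ≤ 1 ∧ ∃ c : Fin n → Fin d → ℝ,
      (∀ j, c j ∈ p z j) ∧ ∑ j, c j = ∑ j, a j + ε • v := by
  set u := ∑ j, a j
  let B : Set (Fin d → ℝ) := ⋃ z ∈ {z ∈ X | u ∉ minkSum (p z)}, minkSum (p z)
  have hB : IsClosed B :=
    (hX.1.finite.subset (Set.sep_subset _ _)).isClosed_biUnion fun z hz =>
      (hX.1.isPolytope hz.1).isCompact.isClosed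
  have huB : u ∉ B := by
    intro h
    obtain ⟨z, hz, huz⟩ := Set.mem_iUnion₂.1 h
    exact hz.2 huz
  have hcont : Filter.Tendsto (fun ε : ℝ => u + ε • v) (nhdsWithin 0 (Set.Ioi 0)) (nhds u) := by
    have : Continuous fun ε : ℝ => u + ε • v := by fun_prop
    have h0 := this.tendsto 0
    rw [zero_smul, add_zero] at h0
    exact h0.mono_left nhdsWithin_le_nhds
  obtain ⟨ε, hεB, hε⟩ := ((hcont.eventually (hB.isOpen_compl.mem_nhds huB)).and
    (Ioc_mem_nhdsGT (lt_min one_pos hδ))).exists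
  have hmem : u + ε • v ∈ suppOf p X := by
    have huX : u ∈ suppOf p X := sum_mem_suppOf hx ha
    have := hX.2.convex.add_smul_mem huX hv (t := ε / δ)
      ⟨div_nonneg hε.1.le hδ.le, (div_le_one hδ).2 (hε.2.trans (min_le_right _ _))⟩
    rwa [smul_smul, div_mul_cancel₀ _ hδ.ne'] at this
  obtain ⟨z, hz, hεz⟩ := mem_suppOf.1 hmem
  have huz : u ∈ minkSum (p z) := by
    by_contra huz
    exact hεB (Set.mem_iUnion₂.2 ⟨z, ⟨hz, huz⟩, hεz⟩)
  exact ⟨z, hz, hX.1.mem_of_sum_mem hmono hx hz ha huz, ε, hε.1, hε.2.trans (min_le_left _ _),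
    mem_minkSum.1 hεz⟩

/-- If from every point of a nonempty compact set one can move straight towards `u` while
staying in the set, then `u` is in the set. -/
theorem IsCompact.mem_of_forall_exists_add_smul_mem {E : Type*} [NormedAddCommGroup E]
    [NormedSpace ℝ E] {K : Set E} (hK : IsCompact K) (hne : K.Nonempty) {u : E}
    (h : ∀ q ∈ K, ∃ ε : ℝ, 0 < ε ∧ ε ≤ 1 ∧ q + ε • (u - q) ∈ K) : u ∈ K := by
  obtain ⟨q, hq, hmin⟩ := hK.exists_isMinOn hne (f := fun q => ‖u - q‖) (by fun_prop)
  obtain ⟨ε, hε, hε1, hmem⟩ := h q hq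
  have hle : ‖u - q‖ ≤ ‖u - (q + ε • (u - q))‖ := hmin hmem
  rw [show u - (q + ε • (u - q)) = (1 - ε) • (u - q) by module, norm_smul, Real.norm_eq_abs,
    abs_of_nonneg (by linarith)] at hle
  have : ‖u - q‖ = 0 := by nlinarith [norm_nonneg (u - q)]
  rwa [sub_eq_zero.1 (norm_eq_zero.1 this)]

/-- The summands of a maximizer of `φ` on the support of a subdivision maximize `φ` on the
components of the `n`-support. -/
theorem IsASubdivision.map_le_map_of_forall_le (hX : IsASubdivision p X)
    (hpoly : ∀ x i, IsPolytope (p x i)) (hmono : ∀ x y : 𝒜, x ≤ y → NPFace (p x) (p y))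
    {φ : (Fin d → ℝ) →ₗ[ℝ] ℝ} {w : 𝒜} (hw : w ∈ X) {b : Fin n → Fin d → ℝ}
    (hb : ∀ j, b j ∈ p w j) (hmax : ∀ y ∈ suppOf p X, φ y ≤ φ (∑ j, b j)) {k : Fin n}
    {c : Fin d → ℝ} (hc : c ∈ nsuppOf p X k) : φ c ≤ φ (b k) := by
  have hφ : Continuous φ := φ.continuous_of_finiteDimensional
  let A : Set (Fin d → ℝ) := ⋃ z ∈ X, (fun a : Fin n → Fin d → ℝ => ∑ j, a j) ''
    (Set.univ.pi (p z) ∩ {a | φ c ≤ φ (a k)})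
  have hA : ∀ {q}, q ∈ A ↔ ∃ z ∈ X, ∃ a : Fin n → Fin d → ℝ, (∀ j, a j ∈ p z j) ∧
      φ c ≤ φ (a k) ∧ ∑ j, a j = q := by
    intro q
    simp [A, and_assoc]
  have hAc : IsCompact A := hX.1.finite.isCompact_biUnion fun z _ =>
    ((isCompact_univ_pi fun j => (hpoly z j).isCompact).inter_right
      (isClosed_le continuous_const (by fun_prop))).image (by fun_prop)
  have hAne : A.Nonempty := by
    obtain ⟨z, hz, hcz⟩ := mem_nsuppOf.1 hc
    choose a ha using fun j => (hpoly z j).nonempty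
    exact ⟨_, hA.2 ⟨z, hz, _, forall_update_mem ha hcz, by simp, rfl⟩⟩
  set u := ∑ j, b j
  have huX : u ∈ suppOf p X := sum_mem_suppOf hw hb
  obtain ⟨q, hq, hqmax⟩ := hAc.exists_isMaxOn hAne hφ.continuousOn
  have hqu : φ u ≤ φ q := by
    by_contra! hlt
    obtain ⟨z₀, hz₀, a, ha₀, hca, rfl⟩ := hA.1 hq
    obtain ⟨z, hz, ha, ε, hε, hε1, e, he, hsum⟩ := hX.exists_cell hmono hz₀ ha₀
      (v := u - ∑ j, a j) one_pos (by rwa [one_smul, add_sub_cancel])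
    have hφe : φ (∑ j, a j) < φ (∑ j, e j) := by
      rw [hsum, map_add, map_smul, map_sub, smul_eq_mul]
      nlinarith
    by_cases hek : φ (a k) ≤ φ (e k)
    · exact absurd (hqmax (hA.2 ⟨z, hz, e, he, hca.trans hek, rfl⟩)) (not_le.2 hφe)
    · have hle : φ (∑ j, Function.update e k (a k) j) ≤ φ (∑ j, a j) :=
        hqmax (hA.2 ⟨z, hz, _, forall_update_mem he (ha k), by simpa using hca, rfl⟩)
      rw [map_sum_update] at hle
      linarith
  have huA : u ∈ A ∩ {q | φ u ≤ φ q} := by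
    refine (hAc.inter_right (isClosed_le continuous_const hφ)).mem_of_forall_exists_add_smul_mem
      ⟨q, hq, hqu⟩ ?_
    rintro q ⟨hq, hqu⟩
    obtain ⟨z₀, hz₀, a, ha₀, hca, rfl⟩ := hA.1 hq
    have hau : φ u = φ (∑ j, a j) := le_antisymm hqu (hmax _ (sum_mem_suppOf hz₀ ha₀))
    obtain ⟨z, hz, ha, ε, hε, hε1, e, he, hsum⟩ := hX.exists_cell hmono hz₀ ha₀
      (v := u - ∑ j, a j) one_pos (by rwa [one_smul, add_sub_cancel])
    have hφe : φ (∑ j, e j) = φ u := by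
      rw [hsum, map_add, map_smul, map_sub, ← hau, sub_self, smul_zero, add_zero]
    refine ⟨ε, hε, hε1, hsum ▸ ⟨hA.2 ⟨z, hz, e, he, hca.trans ?_, rfl⟩, hφe.ge⟩⟩
    have := hmax _ (sum_mem_suppOf hz (forall_update_mem he (ha k)))
    rw [map_sum_update, hφe] at this
    linarith
  obtain ⟨z, hz, a, ha, hca, hau⟩ := hA.1 huA.1
  have haw := hX.1.mem_of_sum_mem hmono hz hw ha (hau ▸ sum_mem_minkSum hb)
  have := hmax _ (sum_mem_suppOf hw (forall_update_mem hb (haw k)))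
  rw [map_sum_update] at this
  linarith

theorem IsASubdivision.nonempty (hX : IsASubdivision p X) : X.Nonempty := by
  obtain ⟨u, hu⟩ := hX.2.nonempty
  obtain ⟨x, hx, -⟩ := mem_suppOf.1 hu
  exact ⟨x, hx⟩

theorem IsASubdivision.sum_mem_suppOf_of_forall_mem_nsuppOf (hX : IsASubdivision p X)
    (hpoly : ∀ x i, IsPolytope (p x i)) (hmono : ∀ x y : 𝒜, x ≤ y → NPFace (p x) (p y))
    {g : Fin n → Fin d → ℝ} (hg : ∀ j, g j ∈ nsuppOf p X j) : ∑ j, g j ∈ suppOf p X := by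
  by_contra hnot
  obtain ⟨φ, s, hs, hsg⟩ := geometric_hahn_banach_closed_point hX.2.convex
    hX.2.isCompact.isClosed hnot
  obtain ⟨u, hu, hmax⟩ := hX.2.isCompact.exists_isMaxOn hX.2.nonempty φ.continuous.continuousOn
  obtain ⟨w, hw, huw⟩ := mem_suppOf.1 hu
  obtain ⟨b, hb, rfl⟩ := mem_minkSum.1 huw
  have hle : ∑ j, φ (g j) ≤ ∑ j, φ (b j) := Finset.sum_le_sum fun j _ =>
    hX.map_le_map_of_forall_le hpoly hmono (φ := φ.toLinearMap) hw hb hmax (hg j)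
  rw [← map_sum, ← map_sum] at hle
  linarith [hs _ hu]

/-- The support of a subdivision is the Minkowski sum of its `n`-support. -/
theorem IsASubdivision.suppOf_eq (hX : IsASubdivision p X)
    (hpoly : ∀ x i, IsPolytope (p x i)) (hmono : ∀ x y : 𝒜, x ≤ y → NPFace (p x) (p y)) :
    suppOf p X = minkSum (nsuppOf p X) := by
  ext u
  constructor
  · intro hu
    obtain ⟨x, hx, hux⟩ := mem_suppOf.1 hu
    obtain ⟨a, ha, rfl⟩ := mem_minkSum.1 hux
    exact sum_mem_minkSum fun j => mem_nsuppOf.2 ⟨x, hx, ha j⟩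
  · intro hu
    obtain ⟨g, hg, rfl⟩ := mem_minkSum.1 hu
    exact hX.sum_mem_suppOf_of_forall_mem_nsuppOf hpoly hmono hg

/-- Rescaling the summands of the cells of a subdivision by positive factors gives a covering of
the rescaled Minkowski sum. -/
theorem IsASubdivision.exists_sum_smul_eq (hX : IsASubdivision p X)
    (hpoly : ∀ x i, IsPolytope (p x i)) (hmono : ∀ x y : 𝒜, x ≤ y → NPFace (p x) (p y))
    {G : Fin n → Set (Fin d → ℝ)} (hXG : ∀ j, nsuppOf p X j ⊆ G j)
    (hG : ∀ g : Fin n → Fin d → ℝ, (∀ j, g j ∈ G j) → ∑ j, g j ∈ suppOf p X)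
    {μ : ℝ} (hμ : 0 < μ) (l : Fin n → ℝ) (hl : ∀ j, μ ≤ l j) {g : Fin n → Fin d → ℝ}
    (hg : ∀ j, g j ∈ G j) :
    ∃ z ∈ X, ∃ a : Fin n → Fin d → ℝ, (∀ j, a j ∈ p z j) ∧
      ∑ j, l j • a j = ∑ j, l j • g j := by
  let U : Set (Fin d → ℝ) := ⋃ z ∈ X, (fun a : Fin n → Fin d → ℝ => ∑ j, l j • a j) ''
    Set.univ.pi (p z)
  have hU : ∀ {q}, q ∈ U ↔ ∃ z ∈ X, ∃ a : Fin n → Fin d → ℝ, (∀ j, a j ∈ p z j) ∧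
      ∑ j, l j • a j = q := by
    intro q
    simp [U]
  have hUc : IsCompact U := hX.1.finite.isCompact_biUnion fun z _ =>
    (isCompact_univ_pi fun j => (hpoly z j).isCompact).image (by fun_prop)
  rw [← hU]
  refine hUc.mem_of_forall_exists_add_smul_mem ?_ fun q hq => ?_
  · obtain ⟨z, hz⟩ := hX.nonempty
    choose a ha using fun j => (hpoly z j).nonempty
    exact ⟨_, hU.2 ⟨z, hz, a, ha, rfl⟩⟩
  obtain ⟨z₀, hz₀, a, ha₀, rfl⟩ := hU.1 hq
  obtain ⟨δ, hδ, hmem⟩ := hX.2.exists_add_smul_mem (v := ∑ j, l j • (g j - a j))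
    (sum_mem_suppOf hz₀ ha₀) fun φ hφ => by
      rw [map_sum]
      refine Finset.sum_nonpos fun j _ => ?_
      rw [map_smul, map_sub, smul_eq_mul]
      refine mul_nonpos_of_nonneg_of_nonpos (hμ.le.trans (hl j)) (sub_nonpos.2 ?_)
      exact le_of_forall_le_map_sum hG
        (fun i => hXG i (mem_nsuppOf.2 ⟨z₀, hz₀, ha₀ i⟩)) hφ (hg j)
  obtain ⟨z, hz, ha, ε, hε, hε1, c, hc, hsum⟩ := hX.exists_cell hmono hz₀ ha₀ hδ hmem
  set r := min 1 (ε * μ)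
  have hr0 : 0 < r := lt_min one_pos (mul_pos hε hμ)
  have hl0 : ∀ j, 0 < l j := fun j => hμ.trans_le (hl j)
  refine ⟨r, hr0, min_le_left _ _, hU.2 ⟨z, hz,
    fun j => a j + (r / (ε * l j)) • (c j - a j), fun j => ?_, ?_⟩⟩
  · have hpos : 0 < ε * l j := mul_pos hε (hl0 j)
    exact (hpoly z j).convex.add_smul_sub_mem (ha j) (hc j) ⟨(div_pos hr0 hpos).le,
      (div_le_one hpos).2 ((min_le_right _ _).trans (mul_le_mul_of_nonneg_left (hl j) hε.le))⟩
  · have hterm : ∀ j, l j • (a j + (r / (ε * l j)) • (c j - a j))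
        = l j • a j + (r / ε) • (c j - a j) := by
      intro j
      have := (hl0 j).ne'
      rw [smul_add, smul_smul]
      congr 2
      field_simp
    rw [Finset.sum_congr rfl fun j _ => hterm j, Finset.sum_add_distrib, ← Finset.smul_sum,
      Finset.sum_sub_distrib, hsum, add_sub_cancel_left, smul_smul, div_mul_cancel₀ _ hε.ne',
      ← Finset.sum_sub_distrib]
    simp only [smul_sub]

/-- If the sets `G j` contain the components of the `n`-support of a subdivision and their
Minkowski sum is contained in the support, then they are the components of the `n`-support. -/
theorem IsASubdivision.subset_nsuppOf (hX : IsASubdivision p X)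
    (hpoly : ∀ x i, IsPolytope (p x i)) (hmono : ∀ x y : 𝒜, x ≤ y → NPFace (p x) (p y))
    {G : Fin n → Set (Fin d → ℝ)} (hXG : ∀ j, nsuppOf p X j ⊆ G j)
    (hG : ∀ g : Fin n → Fin d → ℝ, (∀ j, g j ∈ G j) → ∑ j, g j ∈ suppOf p X) (k : Fin n) :
    G k ⊆ nsuppOf p X k := by
  intro g₀ hg₀
  have hcomp : ∀ j, IsCompact (nsuppOf p X j) := fun j =>
    hX.1.finite.isCompact_biUnion fun z _ => (hpoly z j).isCompact
  obtain ⟨x, hx⟩ := hX.nonempty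
  choose b hb using fun j => (hpoly x j).nonempty
  have hbX : ∀ j, b j ∈ nsuppOf p X j := fun j => mem_nsuppOf.2 ⟨x, hx, hb j⟩
  choose C hC using fun j => Metric.isBounded_iff.1 (hcomp j).isBounded
  set D := ∑ j ∈ Finset.univ.erase k, C j with hD
  have hclose : ∀ μ : ℝ, 0 < μ → μ ≤ 1 → ∃ a ∈ nsuppOf p X k, dist g₀ a ≤ μ * D := by
    intro μ hμ hμ1
    obtain ⟨z, hz, a, ha, hsum⟩ := hX.exists_sum_smul_eq hpoly hmono hXG hG hμ
      (Function.update (fun _ => μ) k 1) (fun j => by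
        by_cases hj : j = k
        · subst hj
          simpa using hμ1
        · simp [hj]) (forall_update_mem (fun j => hXG j (hbX j)) hg₀)
    refine ⟨a k, mem_nsuppOf.2 ⟨z, hz, ha k⟩, ?_⟩
    rw [← Finset.add_sum_erase _ _ (Finset.mem_univ k),
      ← Finset.add_sum_erase _ _ (Finset.mem_univ k)] at hsum
    simp only [Function.update_self, one_smul] at hsum
    have hdiff : g₀ - a k = ∑ j ∈ Finset.univ.erase k, μ • (a j - b j) := by
      have h₁ : ∑ j ∈ Finset.univ.erase k, Function.update (fun _ => μ) k 1 j • a j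
          = ∑ j ∈ Finset.univ.erase k, μ • a j :=
        Finset.sum_congr rfl fun j hj => by rw [Function.update_of_ne (Finset.ne_of_mem_erase hj)]
      have h₂ : ∑ j ∈ Finset.univ.erase k, Function.update (fun _ => μ) k 1 j •
          Function.update b k g₀ j = ∑ j ∈ Finset.univ.erase k, μ • b j :=
        Finset.sum_congr rfl fun j hj => by
          rw [Function.update_of_ne (Finset.ne_of_mem_erase hj),
            Function.update_of_ne (Finset.ne_of_mem_erase hj)]
      rw [h₁, h₂] at hsum
      simp only [smul_sub, Finset.sum_sub_distrib]
      rw [sub_eq_sub_iff_add_eq_add, ← hsum, add_comm]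
    rw [dist_eq_norm, hdiff, hD, Finset.mul_sum]
    refine norm_sum_le_of_le _ fun j _ => ?_
    rw [norm_smul, Real.norm_of_nonneg hμ.le, ← dist_eq_norm]
    exact mul_le_mul_of_nonneg_left (hC j (mem_nsuppOf.2 ⟨z, hz, ha j⟩) (hbX j)) hμ.le
  rw [← (hcomp k).isClosed.closure_eq, Metric.mem_closure_iff]
  intro η hη
  have hD1 : 0 < |D| + 1 := by positivity
  obtain ⟨a, ha, hle⟩ := hclose (min 1 (η / (|D| + 1))) (lt_min one_pos (div_pos hη hD1))
    (min_le_left _ _)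
  refine ⟨a, ha, hle.trans_lt ?_⟩
  have hm : 0 < min 1 (η / (|D| + 1)) := lt_min one_pos (div_pos hη hD1)
  calc min 1 (η / (|D| + 1)) * D
      < min 1 (η / (|D| + 1)) * (|D| + 1) :=
        mul_lt_mul_of_pos_left ((le_abs_self D).trans_lt (lt_add_one _)) hm
    _ ≤ η / (|D| + 1) * (|D| + 1) := mul_le_mul_of_nonneg_right (min_le_right _ _) hD1.le
    _ = η := div_mul_cancel₀ _ hD1.ne'

/-- The cells of a subdivision contained in a face of its support form a subdivision of this
face. -/
theorem IsASubdivision.subdLE_setOf_subset (hX : IsASubdivision p X) {F : Set (Fin d → ℝ)}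
    (hF : IsFaceOf F (suppOf p X)) :
    SubdLE p {z ∈ X | minkSum (p z) ⊆ F} X ∧ suppOf p {z ∈ X | minkSum (p z) ⊆ F} = F := by
  obtain ⟨hne, φ, hφ⟩ := hF
  have hsupp : suppOf p {z ∈ X | minkSum (p z) ⊆ F} = F := by
    refine subset_antisymm (fun u hu => ?_) fun u hu => ?_
    · obtain ⟨z, hz, huz⟩ := mem_suppOf.1 hu
      exact hz.2 huz
    · have hu' := hu
      rw [hφ] at hu'
      obtain ⟨z, hz, huz⟩ := mem_suppOf.1 hu'.1
      have hsub : ∀ y ∈ minkSum (p z), y ∈ suppOf p X := fun y hy => mem_suppOf.2 ⟨z, hz, hy⟩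
      obtain ⟨w, hw, -, hwz⟩ := hX.1.exists_le_of_isFaceOf hz
        (F := maxFace φ (minkSum (p z))) ⟨⟨u, huz, fun y hy => hu'.2 y (hsub y hy)⟩, φ, rfl⟩
      refine mem_suppOf.2 ⟨w, ⟨hw, ?_⟩, ?_⟩
      · rw [hwz, hφ]
        exact fun y hy => ⟨hsub y hy.1, fun q hq => (hu'.2 q hq).trans (hy.2 u huz)⟩
      · rw [hwz]
        exact ⟨huz, fun y hy => hu'.2 y (hsub y hy)⟩
  refine ⟨⟨Set.sep_subset _ _, hX.1.mono (Set.sep_subset _ _) fun y hy x hx hxy => ⟨hx, ?_⟩,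
    hsupp.symm ▸ ⟨hne, φ, hφ⟩⟩, hsupp⟩
  obtain ⟨-, ψ, hψ⟩ := (hX.1.2.2 x hx y hy.1).1 hxy
  rw [hψ]
  exact (Set.sep_subset _ _).trans hy.2

/-- Every face of the `n`-support of a subdivision is the `n`-support of a subdivision below it. -/
theorem IsASubdivision.exists_subdLE_nsuppOf_eq (hX : IsASubdivision p X)
    (hpoly : ∀ x i, IsPolytope (p x i)) (hmono : ∀ x y : 𝒜, x ≤ y → NPFace (p x) (p y))
    {G : Fin n → Set (Fin d → ℝ)} (hG : NPFace G (nsuppOf p X)) :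
    ∃ Y, SubdLE p Y X ∧ nsuppOf p Y = G := by
  obtain ⟨φ, hφ⟩ := hG
  have hmem : ∀ {j a}, a ∈ G j ↔
      a ∈ nsuppOf p X j ∧ ∀ b ∈ nsuppOf p X j, φ b ≤ φ a := by
    intro j a
    conv_lhs => rw [(hφ j).2]
    rfl
  have hsum : ∀ g : Fin n → Fin d → ℝ, (∀ j, g j ∈ G j) →
      ∑ j, g j ∈ maxFace φ (suppOf p X) := by
    refine fun g hg => ⟨hX.sum_mem_suppOf_of_forall_mem_nsuppOf hpoly hmono
      fun j => (hmem.1 (hg j)).1, fun y hy => ?_⟩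
    rw [hX.suppOf_eq hpoly hmono] at hy
    obtain ⟨a, ha, rfl⟩ := mem_minkSum.1 hy
    rw [map_sum, map_sum]
    exact Finset.sum_le_sum fun j _ => (hmem.1 (hg j)).2 _ (ha j)
  choose g hg using fun j => (hφ j).1
  obtain ⟨hYX, hY⟩ := hX.subdLE_setOf_subset (F := maxFace φ (suppOf p X)) ⟨⟨_, hsum g hg⟩, φ, rfl⟩
  set Y := {z ∈ X | minkSum (p z) ⊆ maxFace φ (suppOf p X)}
  have hle : ∀ j, nsuppOf p Y j ⊆ G j := by
    intro j a ha
    obtain ⟨z, hz, haz⟩ := mem_nsuppOf.1 ha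
    choose b hb using fun i => (hpoly z i).nonempty
    have hab := forall_update_mem hb haz
    refine hmem.2 ⟨mem_nsuppOf.2 ⟨z, hz.1, haz⟩, fun c hc => ?_⟩
    simpa using le_of_forall_le_map_sum
      (fun g hg => hX.sum_mem_suppOf_of_forall_mem_nsuppOf hpoly hmono hg)
      (fun i => mem_nsuppOf.2 ⟨z, hz.1, hab i⟩) (hz.2 (sum_mem_minkSum hab)).2 hc
  exact ⟨Y, hYX, funext fun j => subset_antisymm (hle j) ((hYX.isASubdivision hX).subset_nsuppOf
    hpoly hmono hle (fun g hg => hY.symm ▸ hsum g hg) j)⟩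

/-- A subdivision below a given one is determined by its `n`-support. -/
theorem SubdLE.eq_of_nsuppOf_eq {Y Z : Set 𝒜} (hY : SubdLE p Y X) (hZ : SubdLE p Z X)
    (hX : IsASubdivision p X) (hpoly : ∀ x i, IsPolytope (p x i))
    (hmono : ∀ x y : 𝒜, x ≤ y → NPFace (p x) (p y)) (h : nsuppOf p Y = nsuppOf p Z) : Y = Z := by
  have hsupp : suppOf p Y = suppOf p Z := by
    rw [(hY.isASubdivision hX).suppOf_eq hpoly hmono, (hZ.isASubdivision hX).suppOf_eq hpoly hmono,
      h]
  exact subset_antisymm (hX.1.subset_of_suppOf_subset hY.1 hZ.1 hZ.2.1 hsupp.subset)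
    (hX.1.subset_of_suppOf_subset hZ.1 hY.1 hY.2.1 hsupp.superset)

end AComplex

theorem statement6 (d n : ℕ) (hn : 0 < n) {𝒜 𝒜' : Type*} [PartialOrder 𝒜] [PartialOrder 𝒜']
    (p : 𝒜 → Fin n → Set (Fin d → ℝ)) (p' : 𝒜' → Fin n → Set (Fin d → ℝ))
    (hpoly : ∀ x i, IsPolytope (p x i))
    (hmono : ∀ x y : 𝒜, x ≤ y → NPFace (p x) (p y))
    (hpoly' : ∀ x i, IsPolytope (p' x i))
    (hmono' : ∀ x y : 𝒜', x ≤ y → NPFace (p' x) (p' y))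
    (Sd : 𝒜 → Set 𝒜')
    (hsubd : ∀ x, IsASubdivision p' (Sd x))
    (hns : ∀ x, nsuppOf p' (Sd x) = p x) :
    (∀ x y : 𝒜, y ≤ x → SubdLE p' (Sd y) (Sd x)) ↔
      (∀ x y : 𝒜, y ≤ x → ∀ Y : Set 𝒜', SubdLE p' Y (Sd x) → nsuppOf p' Y = p y →
        Y = Sd y) := by
  refine ⟨fun h x y hyx Y hY hYy => ?_, fun h x y hyx => ?_⟩
  · exact hY.eq_of_nsuppOf_eq (h x y hyx) (hsubd x) hpoly' hmono' (hYy.trans (hns y).symm)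
  · obtain ⟨Y, hY, hYy⟩ := (hsubd x).exists_subdLE_nsuppOf_eq hpoly' hmono' (G := p y)
      ((hns x).symm ▸ hmono y x hyx)
    exact h x y hyx Y hY hYy ▸ hY
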